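/- Let H be an infinite-dimensional separable complex Hilbert space, let a > 0, and let X_a be the set of all bounded self-adjoint operators A on H with ‖A‖ ≤ a, equipped with the topology of strong operator convergence. Then the set of A ∈ X_a that have no eigenvalues (there is no nonzero ψ ∈ H and E ∈ ℝ with Aψ = Eψ) contains a dense G_δ subset of X_a. -/

import Mathlib

/-- `Xa H a` is the set of bounded self-adjoint operators on `H` of norm at most `a`. -/
def Xa (H : Type*) [NormedAddCommGroup H] [InnerProductSpace ℂ H] [CompleteSpace H]
    (a : ℝ) : Type _ :=
  {A : H →L[ℂ] H // IsSelfAdjoint A ∧ ‖A‖ ≤ a}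

/-- The strong operator topology on `Xa H a`: the topology of pointwise (strong)
convergence, i.e. the topology induced from the product topology on `H → H` via
`A ↦ (A : H → H)`. -/
instance XaSOT (H : Type*) [NormedAddCommGroup H] [InnerProductSpace ℂ H] [CompleteSpace H]
    (a : ℝ) : TopologicalSpace (Xa H a) :=
  TopologicalSpace.induced (fun A : Xa H a => (A.1 : H → H)) Pi.topologicalSpace

open MeasureTheory Filter Topology Set

lemma aux_orth_countable {H : Type*} [NormedAddCommGroup H] [InnerProductSpace ℂ H]
    [TopologicalSpace.SeparableSpace H] {ι : Type*} {v : ι → H} (hv : Orthonormal ℂ v) :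
    Countable ι := by
  refine Pairwise.countable_of_isOpen_disjoint (s := fun i => Metric.ball (v i) (1/2)) ?_ 
    (fun i => Metric.isOpen_ball) (fun i => ⟨v i, Metric.mem_ball_self (by norm_num)⟩)
  intro i j hij
  apply Metric.ball_disjoint_ball
  have h1 : inner ℂ (v i) (v i - v j) = (1:ℂ) := by
    rw [inner_sub_right, hv.2 hij, inner_self_eq_norm_sq_to_K, hv.1 i]; simp
  have h2 := norm_inner_le_norm (𝕜 := ℂ) (v i) (v i - v j)
  rw [h1, hv.1 i] at h2
  rw [dist_eq_norm]
  norm_num at h2 ⊢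
  exact h2

lemma aux_unitary {H L : Type*} [NormedAddCommGroup H] [InnerProductSpace ℂ H]
    [CompleteSpace H] [TopologicalSpace.SeparableSpace H]
    [NormedAddCommGroup L] [InnerProductSpace ℂ L]
    [CompleteSpace L] [TopologicalSpace.SeparableSpace L]
    (hinf : ¬ FiniteDimensional ℂ H) {n : ℕ} {e : Fin n → H} (he : Orthonormal ℂ e)
    {f : ℕ → L} (hf : Orthonormal ℂ f) :
    ∃ U : H ≃ₗᵢ[ℂ] L, ∀ j, U (e j) = f j := by
  classical
  obtain ⟨w, b, hsw, hb⟩ := he.toSubtypeRange.exists_hilbertBasis_extension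
  obtain ⟨w', b', hsw', hb'⟩ := hf.toSubtypeRange.exists_hilbertBasis_extension
  have hc : Countable w := aux_orth_countable b.orthonormal
  have hc' : Countable w' := aux_orth_countable b'.orthonormal
  have hwi : Infinite w := by
    by_contra h
    rw [not_infinite_iff_finite] at h
    have hd := b.dense_span
    have hfin : FiniteDimensional ℂ (Submodule.span ℂ (range b)) :=
      FiniteDimensional.span_of_finite ℂ (finite_range b)
    rw [(Submodule.closed_of_finiteDimensional _).submodule_topologicalClosure_eq] at hd
    rw [hd] at hfin
    exact hinf (Module.finite_def.2 (by rwa [← Module.Finite.iff_fg]))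
  have hwi' : Infinite w' := 
    Infinite.of_injective (fun k => (⟨f k, hsw' ⟨k, rfl⟩⟩ : w')) 
      (fun i j h => hf.linearIndependent.injective (congrArg Subtype.val h))
  -- the finite partial bijection
  let ew : Fin n → w := fun j => ⟨e j, hsw ⟨j, rfl⟩⟩
  let fw : Fin n → w' := fun j => ⟨f j, hsw' ⟨j, rfl⟩⟩
  have hew : Function.Injective ew := fun i j h =>
    he.linearIndependent.injective (congrArg Subtype.val h)
  have hfw : Function.Injective fw := fun i j h =>
    Fin.ext (hf.linearIndependent.injective (congrArg Subtype.val h))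
  let s : Set w := range ew
  let q : s ↪ w' := (Equiv.ofInjective ew hew).symm.toEmbedding.trans ⟨fw, hfw⟩
  have hg : ∃ g : w ≃ w', ∀ x : s, g x = q x := by
    apply Cardinal.extend_function
    have i1 : Infinite (sᶜ : Set w) := (finite_range ew).infinite_compl.to_subtype
    have i2 : Infinite ((range q)ᶜ : Set w') := by
      have : Finite s := finite_range ew
      exact (finite_range q).infinite_compl.to_subtype
    exact nonempty_equiv_of_countable
  obtain ⟨g, hg⟩ := hg
  have hgj : ∀ j, g (ew j) = fw j := by
    intro j
    have := hg ⟨ew j, j, rfl⟩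
    rw [this]
    simp only [q, Function.Embedding.trans_apply, Function.Embedding.coeFn_mk]
    congr 1
    rw [Equiv.symm_apply_eq]; rfl
  let b'' : HilbertBasis w ℂ L := HilbertBasis.mk (v := b' ∘ g) 
    (b'.orthonormal.comp g g.injective) (by
      rw [range_comp, g.range_eq_univ, image_univ, b'.dense_span])
  have hb'' : ⇑b'' = b' ∘ g := HilbertBasis.coe_mk _ _
  refine ⟨b.repr.trans b''.repr.symm, fun j => ?_⟩
  have h1 : e j = b (ew j) := by rw [hb]
  rw [h1, LinearIsometryEquiv.trans_apply, b.repr_self, b''.repr_symm_single, hb'']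
  simp [hgj, hb', fw]

lemma aux_mul (g : ℝ → ℝ) (hg : Measurable g) {a : ℝ} (ha : 0 ≤ a) (hb : ∀ x, |g x| ≤ a) :
    ∃ M : Lp ℂ 2 (volume : Measure ℝ) →L[ℂ] Lp ℂ 2 (volume : Measure ℝ),
      ‖M‖ ≤ a ∧ ∀ f, M f =ᵐ[volume] fun x => (g x : ℂ) * f x := by
  have hm : MemLp (fun x => (g x : ℂ)) ⊤ (volume : Measure ℝ) := 
    memLp_top_of_bound (Complex.measurable_ofReal.comp hg).aestronglyMeasurable a
      (Eventually.of_forall (fun x => by simpa using hb x))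
  let M := (ContinuousLinearMap.mul ℂ ℂ).holderL (volume : Measure ℝ) ⊤ 2 2 hm.toLp
  have hM : ∀ f, M f =ᵐ[volume] fun x => (g x : ℂ) * f x := by
    intro f
    filter_upwards [(ContinuousLinearMap.mul ℂ ℂ).coeFn_holder (r := 2) hm.toLp f, hm.coeFn_toLp] with x h1 h2
    simp only [M, ContinuousLinearMap.holderL_apply_apply]
    rw [h1, h2]; rfl
  refine ⟨M, ContinuousLinearMap.opNorm_le_bound _ ha (fun f => ?_), hM⟩
  apply Lp.norm_le_mul_norm_of_ae_le_mul
  filter_upwards [hM f] with x hx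
  rw [hx, norm_mul]
  gcongr
  simpa using hb x

lemma aux_mul_sym (g : ℝ → ℝ) 
    (M : Lp ℂ 2 (volume : Measure ℝ) →L[ℂ] Lp ℂ 2 (volume : Measure ℝ))
    (hM : ∀ f, M f =ᵐ[volume] fun x => (g x : ℂ) * f x) (u v : Lp ℂ 2 (volume : Measure ℝ)) :
    inner ℂ (M u) v = inner ℂ u (M v) := by
  rw [L2.inner_def, L2.inner_def]
  apply integral_congr_ae
  filter_upwards [hM u, hM v] with x h1 h2
  rw [h1, h2]
  simp only [RCLike.inner_apply, map_mul, Complex.conj_ofReal]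
  ring

lemma aux_mul_eig (g : ℝ → ℝ) (hg : ∀ E, (volume : Measure ℝ) {x | g x = E} = 0)
    (M : Lp ℂ 2 (volume : Measure ℝ) →L[ℂ] Lp ℂ 2 (volume : Measure ℝ))
    (hM : ∀ f, M f =ᵐ[volume] fun x => (g x : ℂ) * f x) (u : Lp ℂ 2 (volume : Measure ℝ))
    (E : ℝ) (hu : M u = (E : ℂ) • u) : u = 0 := by
  have h0 : ∀ᵐ x ∂(volume : Measure ℝ), g x ≠ E := by
    rw [ae_iff]; simpa using hg E
  apply Lp.ext
  have h1 := hM u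
  rw [hu] at h1
  filter_upwards [h0, h1, Lp.coeFn_smul (E : ℂ) u, Lp.coeFn_zero ℂ 2 (volume : Measure ℝ)] with x a1 a2 a3 a4
  rw [a3] at a2
  rw [a4]
  simp only [Pi.smul_apply, smul_eq_mul, Pi.zero_apply] at a2 ⊢
  by_contra h
  have := mul_right_cancel₀ h a2
  exact a1 (by exact_mod_cast this.symm)

noncomputable def auxF (k : ℕ) : Lp ℂ 2 (volume : Measure ℝ) :=
  indicatorConstLp 2 (s := Ico (k:ℝ) (k+1)) measurableSet_Ico (by simp) (1:ℂ)

lemma auxF_orth : Orthonormal ℂ auxF := by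
  rw [orthonormal_iff_ite]
  intro i j
  rw [auxF, auxF, L2.inner_indicatorConstLp_one_indicatorConstLp_one _ _ (by simp) (by simp)]
  split_ifs with h
  · subst h; simp
  · have : Ico (i:ℝ) (i+1) ∩ Ico (j:ℝ) (j+1) = ∅ := by
      ext x
      simp only [mem_inter_iff, mem_Ico, mem_empty_iff_false, iff_false]
      rintro ⟨⟨h1, h2⟩, h3, h4⟩
      have a1 : i < j + 1 := by exact_mod_cast h1.trans_lt h4
      have a2 : j < i + 1 := by exact_mod_cast h3.trans_lt h2
      omega
    simp [this]

noncomputable def auxG (a : ℝ) (l : ℕ → ℝ) (d : ℝ) (x : ℝ) : ℝ :=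
  (1 - d) * l ⌊x⌋.toNat + d * (a * Int.fract x)

lemma auxG_meas (a l d) : Measurable (auxG a l d) := by
  unfold auxG
  have : Measurable (fun x : ℝ => l ⌊x⌋.toNat) := 
    (measurable_from_top (f := fun k : ℤ => l k.toNat)).comp Int.measurable_floor
  fun_prop

lemma auxG_bound {a l d} (hl : ∀ k, |l k| ≤ a) (hd : 0 ≤ d) (hd' : d ≤ 1) (x) :
    |auxG a l d x| ≤ a := by
  unfold auxG
  have h1 := hl ⌊x⌋.toNat
  have ha : 0 ≤ a := (abs_nonneg _).trans h1
  have h2 := Int.fract_nonneg x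
  have h3 := (Int.fract_lt_one x).le
  calc _ ≤ |(1 - d) * l ⌊x⌋.toNat| + |d * (a * Int.fract x)| := abs_add_le _ _
    _ = (1-d) * |l ⌊x⌋.toNat| + d * (a * Int.fract x) := by
      rw [abs_mul, abs_of_nonneg (sub_nonneg.2 hd'), abs_of_nonneg (by positivity : 0 ≤ d * (a * Int.fract x))]
    _ ≤ (1-d) * a + d * (a * 1) := by gcongr
    _ = a := by ring

lemma auxG_level {a l d} (ha : 0 < a) (hd : 0 < d) (E : ℝ) :
    (volume : Measure ℝ) {x | auxG a l d x = E} = 0 := by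
  apply Set.Countable.measure_zero
  have : InjOn (fun x : ℝ => ⌊x⌋) {x | auxG a l d x = E} := by
    intro x hx y hy hxy
    simp only [mem_ofPred_eq, auxG] at hx hy hxy
    rw [← hy, hxy] at hx
    have h : Int.fract x = Int.fract y := by
      have := mul_left_cancel₀ hd.ne' (add_left_cancel hx)
      exact mul_left_cancel₀ ha.ne' this
    rw [← Int.floor_add_fract x, ← Int.floor_add_fract y, h, hxy]
  exact (mapsTo_univ _ _).countable_of_injOn this countable_univ

lemma auxG_near {a l d} (hl : ∀ k, |l k| ≤ a) (hd : 0 ≤ d) 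
    (M : Lp ℂ 2 (volume : Measure ℝ) →L[ℂ] Lp ℂ 2 (volume : Measure ℝ))
    (hM : ∀ f, M f =ᵐ[volume] fun x => (auxG a l d x : ℂ) * f x) (k : ℕ) :
    ‖M (auxF k) - (l k : ℂ) • auxF k‖ ≤ 2 * a * d := by
  have hn : ‖auxF k‖ = 1 := auxF_orth.1 k
  rw [← mul_one (2 * a * d), ← hn]
  apply Lp.norm_le_mul_norm_of_ae_le_mul
  have hf : auxF k =ᵐ[volume] (Ico (k:ℝ) (k+1)).indicator fun _ => (1:ℂ) := indicatorConstLp_coeFn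
  filter_upwards [hM (auxF k), Lp.coeFn_sub (M (auxF k)) ((l k : ℂ) • auxF k), 
    Lp.coeFn_smul (l k : ℂ) (auxF k), hf] with x h1 h2 h3 h4
  rw [h2, Pi.sub_apply, h1, h3, Pi.smul_apply, smul_eq_mul, ← sub_mul, norm_mul]
  by_cases hx : x ∈ Ico (k:ℝ) (k+1)
  · gcongr
    have hfl : ⌊x⌋ = (k:ℤ) := by
      rw [Int.floor_eq_iff]; exact_mod_cast hx
    rw [← Complex.ofReal_sub, Complex.norm_real, Real.norm_eq_abs, auxG, hfl, Int.toNat_natCast]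
    have e1 : (1 - d) * l k + d * (a * Int.fract x) - l k = d * (a * Int.fract x - l k) := by ring
    have h2 := Int.fract_nonneg x
    have h3 := (Int.fract_lt_one x).le
    have h5 := abs_le.1 (hl k)
    have ha : 0 ≤ a := (abs_nonneg _).trans (hl k)
    have h6 : a * Int.fract x ≤ a * 1 := by gcongr
    have h7 : 0 ≤ a * Int.fract x := by positivity
    rw [e1, abs_mul, abs_of_nonneg hd, mul_comm]
    gcongr
    rw [abs_le]; constructor <;> linarith
  · rw [h4]; simp [hx]

lemma aux_dense {H : Type*} [NormedAddCommGroup H] [InnerProductSpace ℂ H]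
    [CompleteSpace H] [TopologicalSpace.SeparableSpace H]
    (hinf : ¬ FiniteDimensional ℂ H) {a : ℝ} (ha : 0 < a) (A : Xa H a) (I : Finset H) :
    ∃ B : ℕ → Xa H a, (∀ m (E : ℝ) (ψ : H), (B m).1 ψ = (E : ℂ) • ψ → ψ = 0) ∧
      ∀ x ∈ I, Tendsto (fun m => (B m).1 x) atTop (𝓝 (A.1 x)) := by
  classical
  let F : Submodule ℂ H := Submodule.span ℂ ((I : Set H) ∪ (A.1 '' I))
  have hF : FiniteDimensional ℂ F :=
    FiniteDimensional.span_of_finite ℂ (I.finite_toSet.union (I.finite_toSet.image _))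
  let T : F →ₗ[ℂ] F := (F.orthogonalProjectionOnto.comp (A.1.comp F.subtypeL)).toLinearMap
  have hTi : ∀ x y : F, inner ℂ x (T y) = inner ℂ (x : H) (A.1 y) := by
    intro x y
    simp [T]
  have hT : T.IsSymmetric := by
    intro x y
    rw [hTi, ← inner_conj_symm, hTi, inner_conj_symm]
    exact A.2.1.isSymmetric x y
  obtain ⟨n, hn⟩ : ∃ n, Module.finrank ℂ F = n := ⟨_, rfl⟩
  let e := hT.eigenvectorBasis hn
  let l : ℕ → ℝ := fun k => if h : k < n then hT.eigenvalues hn ⟨k, h⟩ else 0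
  have hlj : ∀ j : Fin n, T (e j) = (l j : ℂ) • e j := by
    intro j
    simp only [l, e, j.2, dif_pos]
    exact hT.apply_eigenvectorBasis hn j
  have hl : ∀ k, |l k| ≤ a := by
    intro k
    by_cases h : k < n
    · have h1 := hTi (e ⟨k, h⟩) (e ⟨k, h⟩)
      rw [hlj, inner_smul_right, inner_self_eq_norm_sq_to_K, e.orthonormal.1] at h1
      have h2 := norm_inner_le_norm (𝕜 := ℂ) (e ⟨k, h⟩ : H) (A.1 (e ⟨k, h⟩))
      rw [← h1] at h2
      have h3 := A.1.le_opNorm (e ⟨k, h⟩)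
      have h4 : ‖(e ⟨k, h⟩ : H)‖ = 1 := e.orthonormal.1 _
      rw [h4] at h2 h3
      simp at h2 h3
      exact h2.trans (h3.trans A.2.2)
    · simp [l, h, ha.le]
  have heo : Orthonormal ℂ (fun j => (e j : H)) := e.orthonormal.comp_linearIsometry F.subtypeₗᵢ
  have : Fact ((2 : ENNReal) ≠ ⊤) := ⟨by simp⟩
  have : SecondCountableTopology (Lp ℂ 2 (volume : Measure ℝ)) := Lp.SecondCountableTopology
  obtain ⟨U, hU⟩ := aux_unitary hinf heo auxF_orth
  let d : ℕ → ℝ := fun m => 1 / ((m : ℝ) + 1)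
  have hd : ∀ m, 0 < d m := fun m => Nat.one_div_pos_of_nat
  have hd1 : ∀ m, d m ≤ 1 := fun m => by
    have : (0:ℝ) ≤ m := Nat.cast_nonneg m
    simp only [d]; rw [div_le_one (by positivity)]; linarith
  have hd0 : Tendsto d atTop (𝓝 0) := tendsto_one_div_add_atTop_nhds_zero_nat
  choose M hMn hM using fun m => aux_mul (auxG a l (d m)) (auxG_meas a l (d m)) ha.le
    (auxG_bound hl (hd m).le (hd1 m))
  let B0 : ℕ → H →L[ℂ] H := fun m =>
    (U.symm.toContinuousLinearEquiv : _ →L[ℂ] H).comp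
      ((M m).comp (U.toContinuousLinearEquiv : H →L[ℂ] _))
  have hB0 : ∀ m x, B0 m x = U.symm (M m (U x)) := fun m x => rfl
  have hsa : ∀ m, IsSelfAdjoint (B0 m) := by
    intro m
    rw [ContinuousLinearMap.isSelfAdjoint_iff_isSymmetric]
    intro x y
    change inner ℂ (B0 m x) y = inner ℂ x (B0 m y)
    rw [hB0, hB0, ← U.inner_map_map, ← U.inner_map_map x, U.apply_symm_apply,
      U.apply_symm_apply]
    exact aux_mul_sym _ _ (hM m) _ _
  have hnorm : ∀ m, ‖B0 m‖ ≤ a := by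
    intro m
    refine ContinuousLinearMap.opNorm_le_bound _ ha.le (fun x => ?_)
    rw [hB0, LinearIsometryEquiv.norm_map]
    refine ((M m).le_opNorm _).trans ?_
    rw [LinearIsometryEquiv.norm_map]
    gcongr
    exact hMn m
  refine ⟨fun m => ⟨B0 m, hsa m, hnorm m⟩, fun m E ψ h => ?_, fun x hx => ?_⟩
  · change B0 m ψ = _ at h
    rw [hB0, LinearIsometryEquiv.symm_apply_eq, map_smul] at h
    have := aux_mul_eig _ (auxG_level ha (hd m)) (M m) (hM m) (U ψ) E h
    simpa using this
  · change Tendsto (fun m => B0 m x) atTop _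
    have hej : ∀ j, Tendsto (fun m => B0 m (e j)) atTop (𝓝 ((T (e j) : F) : H)) := by
      intro j
      rw [tendsto_iff_norm_sub_tendsto_zero]
      have h0 : Tendsto (fun m => 2 * a * d m) atTop (𝓝 0) := by
        simpa using hd0.const_mul (2 * a)
      refine squeeze_zero (fun _ => norm_nonneg _) (fun m => ?_) h0
      have h1 := auxG_near hl (hd m).le (M m) (hM m) j
      rw [← U.norm_map, map_sub, hB0, U.apply_symm_apply, hlj, Submodule.coe_smul, map_smul, hU]
      exact h1
    have hall : ∀ y : F, Tendsto (fun m => B0 m y) atTop (𝓝 ((T y : F) : H)) := by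
      intro y
      have hy := e.sum_repr y
      rw [← hy]
      simp only [map_sum, map_smul, Submodule.coe_sum, Submodule.coe_smul]
      exact tendsto_finsetSum _ (fun j _ => (hej j).const_smul _)
    have hxF : x ∈ F := Submodule.subset_span (Or.inl hx)
    have hAxF : A.1 x ∈ F := Submodule.subset_span (Or.inr ⟨x, hx, rfl⟩)
    have h1 := hall ⟨x, hxF⟩
    have h2 : T ⟨x, hxF⟩ = ⟨A.1 x, hAxF⟩ := by
      change F.orthogonalProjectionOnto (A.1 x) = _
      exact Submodule.orthogonalProjectionOnto_mem_subspace_eq_self (⟨A.1 x, hAxF⟩ : F)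
    rw [h2] at h1
    exact h1

abbrev auxK (H : Type*) [NormedAddCommGroup H] [InnerProductSpace ℂ H] (m : ℕ) : Type _ :=
  (WeakDual.toStrongDual ⁻¹' Metric.closedBall (0 : StrongDual ℂ H) m : Set (WeakDual ℂ H))

lemma aux_eval_cont {H : Type*} [NormedAddCommGroup H] [InnerProductSpace ℂ H] (m : ℕ) :
    Continuous (fun p : auxK H m × H => p.1.1 p.2) := by
  rw [continuous_iff_continuousAt]
  rintro ⟨f0, x0⟩
  have h1 : Tendsto (fun p : auxK H m × H => p.1.1 x0) (𝓝 (f0, x0)) (𝓝 (f0.1 x0)) :=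
    ((WeakDual.eval_continuous x0).comp (continuous_subtype_val.comp continuous_fst)).tendsto _
  have h2 : Tendsto (fun p : auxK H m × H => p.1.1 (p.2 - x0)) (𝓝 (f0, x0)) (𝓝 0) := by
    have h0 : Tendsto (fun p : auxK H m × H => (m:ℝ) * ‖p.2 - x0‖) (𝓝 (f0, x0)) (𝓝 0) := by
      have : Continuous (fun p : auxK H m × H => (m:ℝ) * ‖p.2 - x0‖) := by fun_prop
      simpa using this.tendsto (f0, x0)
    refine squeeze_zero_norm (fun p => ?_) h0
    have hp : ‖WeakDual.toStrongDual p.1.1‖ ≤ m := mem_closedBall_zero_iff.1 p.1.2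
    exact (WeakDual.toStrongDual p.1.1).le_of_opNorm_le hp _
  have := h1.add h2
  simp only [map_sub, add_sub_cancel, add_zero] at this
  exact this

lemma aux_closed {H : Type*} [NormedAddCommGroup H] [InnerProductSpace ℂ H]
    [CompleteSpace H] (a : ℝ) (φ : H) (m : ℕ) :
    IsClosed {A : Xa H a | ∃ (f : auxK H m) (E : Icc (-(m:ℝ)) m),
      (∀ η, f.1 (A.1 η) = (E.1 : ℂ) * f.1 η) ∧ f.1 φ = 1} := by
  have : CompactSpace (auxK H m) := isCompact_iff_compactSpace.1 (WeakDual.isCompact_closedBall 0 _)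
  let C : Set (Xa H a × (auxK H m × Icc (-(m:ℝ)) m)) :=
    {p | (∀ η, p.2.1.1 (p.1.1 η) = (p.2.2.1 : ℂ) * p.2.1.1 η) ∧ p.2.1.1 φ = 1}
  have hA : ∀ η, Continuous (fun A : Xa H a => A.1 η) := fun η =>
    (continuous_apply η).comp continuous_induced_dom
  have hev : ∀ η, Continuous (fun p : Xa H a × (auxK H m × Icc (-(m:ℝ)) m) => p.2.1.1 η) :=
    fun η => (WeakDual.eval_continuous η).comp (continuous_subtype_val.comp
      (continuous_fst.comp continuous_snd))
  have hC : IsClosed C := by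
    simp only [C, ofPred_and, ofPred_forall]
    refine IsClosed.inter (isClosed_iInter fun η => isClosed_eq ?_ ?_) (isClosed_eq (hev φ) continuous_const)
    · exact (aux_eval_cont m).comp ((continuous_fst.comp continuous_snd).prodMk
        ((hA η).comp continuous_fst))
    · exact (Complex.continuous_ofReal.comp (continuous_subtype_val.comp
        (continuous_snd.comp continuous_snd))).mul (hev η)
  have := isClosedMap_fst_of_compactSpace C hC
  convert this using 1
  ext A
  constructor
  · rintro ⟨f, E, h⟩
    exact ⟨(A, f, E), h, rfl⟩
  · rintro ⟨⟨A', f, E⟩, h, rfl⟩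
    exact ⟨f, E, h⟩

theorem sa_generic_no_eigenvalues (H : Type*) [NormedAddCommGroup H] [InnerProductSpace ℂ H]
    [CompleteSpace H] [TopologicalSpace.SeparableSpace H]
    (hinf : ¬ FiniteDimensional ℂ H) (a : ℝ) (ha : 0 < a) :
    ∃ S : Set (Xa H a), IsGδ S ∧ Dense S ∧ ∀ A ∈ S,
      ∀ (E : ℝ) (ψ : H), A.1 ψ = (E : ℂ) • ψ → ψ = 0 := by
  let Z : H → ℕ → Set (Xa H a) := fun φ m => {A : Xa H a | ∃ (f : auxK H m)
    (E : Icc (-(m:ℝ)) m), (∀ η, f.1 (A.1 η) = (E.1 : ℂ) * f.1 η) ∧ f.1 φ = 1}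
  let q := TopologicalSpace.denseSeq H
  have hq := TopologicalSpace.denseRange_denseSeq H
  refine ⟨⋂ n, ⋂ m, (Z (q n) m)ᶜ, ?_, ?_, ?_⟩
  · exact .iInter fun n => .iInter fun m => (aux_closed a (q n) m).isOpen_compl.isGδ
  · intro A
    rw [mem_closure_iff]
    intro o ho hAo
    obtain ⟨V, hV, rfl⟩ := isOpen_induced_iff.1 ho
    obtain ⟨I, u, hu, hIu⟩ := isOpen_pi_iff.1 hV _ hAo
    obtain ⟨B, hB, hBt⟩ := aux_dense hinf ha A I
    have hev : ∀ᶠ m in atTop, ∀ x ∈ I, (B m).1 x ∈ u x := by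
      rw [Filter.eventually_all_finset]
      intro x hx
      exact (hBt x hx).eventually ((hu x hx).1.mem_nhds (hu x hx).2)
    obtain ⟨m, hm⟩ := hev.exists
    refine ⟨B m, hIu (fun x hx => hm x hx), ?_⟩
    simp only [mem_iInter, mem_compl_iff]
    rintro n k ⟨f, E, h1, h2⟩
    let ψ := (InnerProductSpace.toDual ℂ H).symm (WeakDual.toStrongDual f.1)
    have hψ : ∀ x, f.1 x = inner ℂ ψ x := fun x =>
      (InnerProductSpace.toDual_symm_apply (𝕜 := ℂ) (x := x) (y := WeakDual.toStrongDual f.1)).symm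
    have h3 : (B m).1 ψ = (E.1 : ℂ) • ψ := by
      refine ext_inner_right ℂ (fun v => ?_)
      have := h1 v
      rw [hψ, hψ] at this
      rw [inner_smul_left, Complex.conj_ofReal, ← this]
      exact (B m).2.1.isSymmetric ψ v
    rw [hψ, hB m _ _ h3] at h2
    simp at h2
  · intro A hA E ψ h
    by_contra hψ
    obtain ⟨n, hn⟩ : ∃ n, inner ℂ ψ (q n) ≠ 0 := by
      by_contra! hc
      apply hψ
      have : (fun x => inner ℂ ψ x) = fun _ => (0:ℂ) :=
        hq.equalizer (by fun_prop) continuous_const (funext hc)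
      exact inner_self_eq_zero.1 (congrFun this ψ)
    let f : StrongDual ℂ H := (inner ℂ ψ (q n))⁻¹ • InnerProductSpace.toDual ℂ H ψ
    obtain ⟨m, hm⟩ := exists_nat_ge (max ‖f‖ |E|)
    simp only [mem_iInter, mem_compl_iff] at hA
    apply hA n m
    have hf : ∀ x, f x = (inner ℂ ψ (q n))⁻¹ * inner ℂ ψ x := fun x => rfl
    refine ⟨⟨StrongDual.toWeakDual f, by simpa using (le_max_left _ _).trans hm⟩,
      ⟨E, abs_le.1 ((le_max_right _ _).trans hm)⟩, fun η => ?_, ?_⟩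
    · change f _ = _ * f η
      rw [hf, hf]
      have : inner ℂ ψ (A.1 η) = (E:ℂ) * inner ℂ ψ η := by
        rw [← Complex.conj_ofReal, ← inner_smul_left, ← h]
        exact (A.2.1.isSymmetric ψ η).symm
      rw [this]; ring
    · change f _ = 1
      rw [hf, inv_mul_cancel₀ hn]
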